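/- arXiv:1903.11569 — 4 statements merged into one kernel-verified Lean document; each statement's English description precedes it below -/
import Mathlib

section
/- For every d ≥ 1, with r = 1 + ⌊√(4d+1)⌋ there exist nonzero pairwise non-proportional binary forms f_1, …, f_r of degree d over ℂ and nonzero scalars λ_1, …, λ_r ∈ ℂ such that λ_1 f_1^d + ⋯ + λ_r f_r^d = 0 (Molluzzo–Newman–Slater bound: Φ_d(d) ≤ 1 + ⌊√(4d+1)⌋). -/
open MvPolynomial Finset

namespace MolluzzoNewmanSlater

/-- The forms in the dependence: `x^d + ω^j y^d` for `j < m`, together with the monomials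
`x^(d-mk) y^(mk)` for `k ≤ d / m`. -/
noncomputable def form (d m : ℕ) (ω : ℂ) :
    Fin m ⊕ Fin (d / m + 1) → MvPolynomial (Fin 2) ℂ
  | .inl j => C (ω ^ (j : ℕ)) * X 1 ^ d + X 0 ^ d
  | .inr k => X 1 ^ (m * k) * X 0 ^ (d - m * k)

/-- The coefficients in the dependence between the `d`-th powers of the forms `form d m ω`. -/
noncomputable def coef (d m : ℕ) : Fin m ⊕ Fin (d / m + 1) → ℂ
  | .inl _ => 1
  | .inr k => -(m * d.choose (m * k))

lemma mul_le_of_fin {d m : ℕ} (k : Fin (d / m + 1)) : m * (k : ℕ) ≤ d :=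
  (Nat.mul_le_mul_left m (Nat.lt_succ_iff.mp k.2)).trans (Nat.mul_div_le d m)

lemma form_isHomogeneous (d m : ℕ) (ω : ℂ) (i) : (form d m ω i).IsHomogeneous d := by
  rcases i with j | k
  · have h := (isHomogeneous_C (Fin 2) (ω ^ (j : ℕ))).mul (isHomogeneous_X_pow (R := ℂ) 1 d)
    rw [zero_add] at h
    exact h.add (isHomogeneous_X_pow 0 d)
  · have h := (isHomogeneous_X_pow (R := ℂ) (1 : Fin 2) (m * k)).mul
      (isHomogeneous_X_pow (R := ℂ) 0 (d - m * k))
    rwa [Nat.add_sub_cancel' (mul_le_of_fin k)] at h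

lemma eval_form_inl (d m : ℕ) (ω a b : ℂ) (j : Fin m) :
    eval ![a, b] (form d m ω (.inl j)) = ω ^ (j : ℕ) * b ^ d + a ^ d := by
  simp [form]

lemma eval_form_inr (d m : ℕ) (ω a b : ℂ) (k : Fin (d / m + 1)) :
    eval ![a, b] (form d m ω (.inr k)) = b ^ (m * (k : ℕ)) * a ^ (d - m * (k : ℕ)) := by
  simp [form]

lemma form_ne_zero {d m : ℕ} (hd : d ≠ 0) (ω : ℂ) (i) : form d m ω i ≠ 0 := by
  intro h
  rcases i with j | k
  · have := eval_form_inl d m ω 1 0 j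
    simp [h, hd] at this
  · have := eval_form_inr d m ω 1 1 k
    simp [h] at this

/-- A monomial `x^(d-mk) y^(mk)` cannot take nonzero values at both `(1, 0)` and `(0, 1)`. -/
lemma eval_form_inr_eq_zero {d m : ℕ} (hd : d ≠ 0) (ω : ℂ) (k : Fin (d / m + 1)) :
    eval ![1, 0] (form d m ω (.inr k)) = 0 ∨ eval ![0, 1] (form d m ω (.inr k)) = 0 := by
  simp only [eval_form_inr, one_pow, mul_one, one_mul]
  by_cases h : m * (k : ℕ) = 0
  · right; simp [h, hd]
  · left; simp [h]

lemma form_ne_smul {d m : ℕ} (hd : d ≠ 0) (hm : m ≠ 0) {ω : ℂ} (hω : IsPrimitiveRoot ω m)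
    (i i') (hi : i ≠ i') (c : ℂ) : form d m ω i ≠ c • form d m ω i' := by
  intro h
  have hω0 : ω ≠ 0 := hω.ne_zero hm
  have hc : c ≠ 0 := by
    rintro rfl
    exact form_ne_zero hd ω i (by simpa using h)
  have ev (a b : ℂ) :
      eval ![a, b] (form d m ω i) = c * eval ![a, b] (form d m ω i') := by
    rw [h, smul_eval]
  rcases i with j | k <;> rcases i' with j' | k'
  · have h1 := ev 1 0
    have h2 := ev 0 1
    simp only [eval_form_inl] at h1 h2
    simp [hd] at h1 h2
    rw [← h1, one_mul] at h2
    exact hi (congrArg _ (Fin.ext (hω.pow_inj j.2 j'.2 h2)))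
  · rcases eval_form_inr_eq_zero hd ω k' with h0 | h0
    · have := ev 1 0
      rw [h0, eval_form_inl] at this
      simp [hd] at this
    · have := ev 0 1
      rw [h0, eval_form_inl] at this
      simp [hd, hω0] at this
  · rcases eval_form_inr_eq_zero hd ω k with h0 | h0
    · have := ev 1 0
      rw [h0, eval_form_inl] at this
      exact hc (by simpa [hd] using this.symm)
    · have := ev 0 1
      rw [h0, eval_form_inl] at this
      simp [hd, hω0, hc] at this
  · have h1 := ev 1 1
    have h2 := ev 1 2
    simp only [eval_form_inr, one_pow, mul_one] at h1 h2
    rw [← h1, one_mul] at h2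
    have h3 : m * (k : ℕ) = m * (k' : ℕ) :=
      Nat.pow_right_injective le_rfl (by exact_mod_cast h2)
    exact hi (congrArg _ (Fin.ext (Nat.eq_of_mul_eq_mul_left (Nat.pos_of_ne_zero hm) h3)))

lemma coef_ne_zero {d m : ℕ} (hm : m ≠ 0) (i) : coef d m i ≠ 0 := by
  rcases i with j | k
  · simp [coef]
  · simp [coef, hm, Nat.choose_eq_zero_iff, mul_le_of_fin k]

/-- Orthogonality of the powers of a primitive root of unity. -/
lemma sum_pow_pow_eq_ite {m : ℕ} {ω : ℂ} (hω : IsPrimitiveRoot ω m) (n : ℕ) :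
    ∑ j : Fin m, (ω ^ (j : ℕ)) ^ n = if m ∣ n then (m : ℂ) else 0 := by
  rw [Fin.sum_univ_eq_sum_range (fun j => (ω ^ j) ^ n)]
  simp_rw [← pow_mul, mul_comm _ n, pow_mul]
  split_ifs with h
  · simp [(hω.pow_eq_one_iff_dvd n).2 h]
  · have h1 : ω ^ n ≠ 1 := fun h' => h ((hω.pow_eq_one_iff_dvd n).1 h')
    rw [geom_sum_eq h1, ← pow_mul, mul_comm, pow_mul, hω.pow_eq_one]
    simp

lemma sum_range_ite_dvd {M : Type*} [AddCommMonoid M] {d m : ℕ} (hm : m ≠ 0) (g : ℕ → M) :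
    ∑ n ∈ range (d + 1), (if m ∣ n then g n else 0) = ∑ k : Fin (d / m + 1), g (m * k) := by
  rw [Fin.sum_univ_eq_sum_range (fun k => g (m * k)), ← sum_filter]
  symm
  refine sum_bij (fun k _ => m * k) ?_ ?_ ?_ (fun _ _ => rfl)
  · intro k hk
    have := mul_le_of_fin ⟨k, mem_range.1 hk⟩
    simp only [mem_filter, mem_range]
    exact ⟨Nat.lt_succ_of_le this, dvd_mul_right _ _⟩
  · intro a _ b _ h
    exact Nat.eq_of_mul_eq_mul_left (Nat.pos_of_ne_zero hm) h
  · intro n hn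
    obtain ⟨hn, k, rfl⟩ := mem_filter.1 hn
    refine ⟨k, mem_range.2 (Nat.lt_succ_of_le ?_), rfl⟩
    rw [Nat.le_div_iff_mul_le (Nat.pos_of_ne_zero hm), mul_comm]
    exact Nat.lt_succ_iff.1 (mem_range.1 hn)

lemma sum_coef_smul_form_pow {d m : ℕ} (hm : m ≠ 0) {ω : ℂ} (hω : IsPrimitiveRoot ω m) :
    ∑ i, coef d m i • form d m ω i ^ d = 0 := by
  have key : ∑ j : Fin m, form d m ω (.inl j) ^ d =
      ∑ n ∈ range (d + 1), if m ∣ n then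
        ((m * d.choose n : ℂ)) • (X 1 ^ n * X 0 ^ (d - n) : MvPolynomial (Fin 2) ℂ) ^ d
        else 0 := by
    simp only [form, add_pow]
    rw [sum_comm]
    refine sum_congr rfl fun n _ => ?_
    have (j : Fin m) : (C (ω ^ (j : ℕ)) * X 1 ^ d) ^ n * (X 0 ^ d) ^ (d - n) *
        ((d.choose n : ℕ) : MvPolynomial (Fin 2) ℂ) =
        ((ω ^ (j : ℕ)) ^ n * d.choose n) • (X 1 ^ n * X 0 ^ (d - n)) ^ d := by
      rw [smul_eq_C_mul, C_mul, C_pow (_ ^ _), map_natCast]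
      ring
    simp_rw [this]
    rw [← sum_smul, ← sum_mul, sum_pow_pow_eq_ite hω]
    split_ifs <;> simp
  rw [Fintype.sum_sum_type]
  simp only [coef, one_smul]
  rw [key, sum_range_ite_dvd hm (fun n => ((m * d.choose n : ℂ)) •
    (X 1 ^ n * X 0 ^ (d - n) : MvPolynomial (Fin 2) ℂ) ^ d), ← sum_add_distrib]
  refine sum_eq_zero fun k _ => ?_
  simp [form]

lemma exists_add_div_eq_sqrt (d : ℕ) :
    ∃ m, m ≠ 0 ∧ m + d / m = Nat.sqrt (4 * d + 1) := by
  have h1 := Nat.sqrt_le (4 * d + 1)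
  have h3 := Nat.lt_succ_sqrt (4 * d + 1)
  generalize Nat.sqrt (4 * d + 1) = s at *
  obtain ⟨t, rfl | rfl⟩ := Nat.even_or_odd' s
  · have ht : t ≠ 0 := by rintro rfl; simp at h3
    refine ⟨t, ht, ?_⟩
    have : d / t = t := by
      rw [Nat.div_eq_iff (Nat.pos_of_ne_zero ht)]
      simp only [Nat.succ_eq_add_one] at h3
      constructor
      · nlinarith
      · have : d < t * t + t := by nlinarith
        omega
    omega
  · refine ⟨t + 1, by omega, ?_⟩
    have : d / (t + 1) = t := by
      rw [Nat.div_eq_iff (show 0 < t + 1 by omega)]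
      simp only [Nat.succ_eq_add_one] at h3
      constructor
      · nlinarith
      · have : d < t * (t + 1) + (t + 1) := by nlinarith
        omega
    omega

end MolluzzoNewmanSlater

open MolluzzoNewmanSlater in
/-- (Molluzzo–Newman–Slater) For every `d ≥ 1`, with
`r = 1 + ⌊√(4d+1)⌋`, there exist `r` nonzero, pairwise non-proportional binary
forms of degree `d` over `ℂ` whose `d`-th powers admit a linear dependence with
all coefficients nonzero; hence `Φ_d(d) ≤ 1 + ⌊√(4d+1)⌋`. -/
theorem molluzzo_newman_slater (d : ℕ) (hd : 1 ≤ d) :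
    ∃ (f : Fin (1 + Nat.sqrt (4 * d + 1)) → MvPolynomial (Fin 2) ℂ)
      (lam : Fin (1 + Nat.sqrt (4 * d + 1)) → ℂ),
      (∀ i, (f i).IsHomogeneous d) ∧ (∀ i, f i ≠ 0) ∧
      (∀ i j, i ≠ j → ∀ c : ℂ, f i ≠ c • f j) ∧
      (∀ i, lam i ≠ 0) ∧ ∑ i, lam i • f i ^ d = 0 := by
  have hd0 : d ≠ 0 := by omega
  obtain ⟨m, hm, hs⟩ := exists_add_div_eq_sqrt d
  have hω := Complex.isPrimitiveRoot_exp m hm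
  let e : Fin (1 + Nat.sqrt (4 * d + 1)) ≃ Fin m ⊕ Fin (d / m + 1) :=
    (finCongr (by omega)).trans finSumFinEquiv.symm
  refine ⟨fun i => form d m _ (e i), fun i => coef d m (e i),
    fun i => form_isHomogeneous _ _ _ _, fun i => form_ne_zero hd0 _ _,
    fun i j hij => form_ne_smul hd0 hm hω _ _ (e.injective.ne hij),
    fun i => coef_ne_zero hm _, ?_⟩
  rw [e.sum_comp (fun i => coef d m i • form d m _ i ^ d)]
  exact sum_coef_smul_form_pow hm hω
end

section
/- Let d ∈ {3,4,5} and k ≥ 2. Then: (a) there exist nonzero pairwise non-proportional binary forms f_1, f_2, f_3, f_4 of degree k over ℂ and nonzero scalars λ_1, …, λ_4 ∈ ℂ with λ_1 f_1^d + λ_2 f_2^d + λ_3 f_3^d + λ_4 f_4^d = 0; and (b) no such triple exists, i.e., there are no three nonzero pairwise non-proportional degree-k forms whose d-th powers satisfy a linear dependence with all coefficients nonzero. Hence Φ_k(d) = 4 for d = 3, 4, 5 and k ≥ 2. -/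
open MvPolynomial Finset

/-- A `𝒲_k(r,d)` set exists: there are `r` nonzero, pairwise non-proportional
binary forms of degree `k` over `ℂ` whose `d`-th powers admit a linear
dependence with all coefficients nonzero. -/
def ExistsWSet (k r d : ℕ) : Prop :=
  ∃ (f : Fin r → MvPolynomial (Fin 2) ℂ) (lam : Fin r → ℂ),
    (∀ i, (f i).IsHomogeneous k) ∧ (∀ i, f i ≠ 0) ∧
    (∀ i j, i ≠ j → ∀ c : ℂ, f i ≠ c • f j) ∧
    (∀ i, lam i ≠ 0) ∧ ∑ i, lam i • f i ^ d = 0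

/-- The quadratic form `t x y + s x² - s³ y²`. -/
noncomputable def trinomialForm (t s : ℂ) : MvPolynomial (Fin 2) ℂ :=
  C t * (X 0 * X 1) + C s * X 0 ^ 2 - C (s ^ 3) * X 1 ^ 2

lemma isHomogeneous_trinomialForm (t s : ℂ) : (trinomialForm t s).IsHomogeneous 2 := by
  refine .sub (.add ?_ ?_) ?_
  · exact ((isHomogeneous_X ℂ 0).mul (isHomogeneous_X ℂ 1)).C_mul t
  · exact (isHomogeneous_X_pow 0 2).C_mul s
  · exact (isHomogeneous_X_pow 1 2).C_mul _

lemma eval_trinomialForm (t s : ℂ) (v : Fin 2 → ℂ) :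
    eval v (trinomialForm t s) = t * (v 0 * v 1) + s * v 0 ^ 2 - s ^ 3 * v 1 ^ 2 := by
  simp [trinomialForm]

lemma eq_of_trinomialForm_eq_smul {t s s' c : ℂ} (ht : t ≠ 0)
    (h : trinomialForm t s = c • trinomialForm t s') : s = s' := by
  have key (v : Fin 2 → ℂ) := congrArg (eval v) h
  simp only [smul_eval, eval_trinomialForm] at key
  have h₁ := key ![1, 1]
  have h₂ := key ![1, -1]
  have h₃ := key ![1, 0]
  simp only [Matrix.cons_val_zero, Matrix.cons_val_one] at h₁ h₂ h₃
  have hc : c = 1 := mul_left_cancel₀ ht (by linear_combination (h₂ - h₁) / 2)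
  subst hc
  linear_combination h₃

lemma trinomialForm_ne_zero {t : ℂ} (ht : t ≠ 0) (s : ℂ) : trinomialForm t s ≠ 0 := fun h ↦
  zero_ne_one <| (eq_of_trinomialForm_eq_smul (s' := 0) (c := 0) ht (by simpa using h)).symm.trans
    (eq_of_trinomialForm_eq_smul (s' := 1) (c := 0) ht (by simpa using h))

/-- The four quadratic forms `trinomialForm t s`, for `s` a fourth root of unity, multiplied by a
power of `x`, form a `𝒲_k(4,d)` set as soon as their `d`-th powers are dependent. -/
lemma existsWSet_four_of_trinomialForm {k d : ℕ} (hk : 2 ≤ k) {t e : ℂ} (ht : t ≠ 0) (he : e ≠ 0)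
    (h : trinomialForm t 1 ^ d + trinomialForm t (-1) ^ d +
      C e * trinomialForm t Complex.I ^ d + C e * trinomialForm t (-Complex.I) ^ d = 0) :
    ExistsWSet k 4 d := by
  have hX : (X 0 : MvPolynomial (Fin 2) ℂ) ^ (k - 2) ≠ 0 := pow_ne_zero _ (X_ne_zero 0)
  have hs : Function.Injective ![1, -1, Complex.I, -Complex.I] := by
    intro i j hij
    fin_cases i <;> fin_cases j <;> simp [Complex.ext_iff] at hij ⊢ <;> norm_num at hij
  refine ⟨fun i ↦ X 0 ^ (k - 2) * trinomialForm t (![1, -1, Complex.I, -Complex.I] i),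
    ![1, 1, e, e], fun i ↦ ?_, fun i ↦ mul_ne_zero hX (trinomialForm_ne_zero ht _),
    fun i j hij c hc ↦ hij (hs ?_), fun i ↦ ?_, ?_⟩
  · simpa [Nat.sub_add_cancel hk] using
      (isHomogeneous_X_pow (R := ℂ) (0 : Fin 2) (k - 2)).mul (isHomogeneous_trinomialForm t _)
  · rw [← mul_smul_comm] at hc
    exact eq_of_trinomialForm_eq_smul ht (mul_left_cancel₀ hX hc)
  · fin_cases i <;> simp [he]
  · simp only [Fin.sum_univ_four, smul_eq_C_mul, mul_pow]
    simp only [Matrix.cons_val, map_one]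
    linear_combination (X 0 ^ (k - 2)) ^ d * h

lemma trinomialForm_cube_sum {t : ℂ} (ht : t ^ 2 = 6) :
    trinomialForm t 1 ^ 3 + trinomialForm t (-1) ^ 3 +
      C 1 * trinomialForm t Complex.I ^ 3 + C 1 * trinomialForm t (-Complex.I) ^ 3 = 0 := by
  refine MvPolynomial.funext fun v ↦ ?_
  simp only [map_add, map_mul, map_pow, map_zero, eval_C, eval_trinomialForm]
  have hI := Complex.I_sq
  have hI3 : Complex.I ^ 3 = -Complex.I := Complex.I_pow_three
  have hn3 : (-Complex.I) ^ 3 = Complex.I := by rw [Odd.neg_pow (by decide), hI3, neg_neg]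
  rw [hI3, hn3]
  generalize Complex.I = i at *
  generalize v 0 = x
  generalize v 1 = y
  linear_combination 6 * t * x * y * (x ^ 2 + y ^ 2) ^ 2 * hI + 4 * t * x ^ 3 * y ^ 3 * ht

lemma trinomialForm_fourth_sum {t : ℂ} (ht : t ^ 2 = 2 / 3) :
    trinomialForm t 1 ^ 4 + trinomialForm t (-1) ^ 4 +
      C (-1) * trinomialForm t Complex.I ^ 4 + C (-1) * trinomialForm t (-Complex.I) ^ 4 = 0 := by
  refine MvPolynomial.funext fun v ↦ ?_
  simp only [map_add, map_mul, map_pow, map_zero, eval_C, eval_trinomialForm]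
  have hI := Complex.I_sq
  have hI3 : Complex.I ^ 3 = -Complex.I := Complex.I_pow_three
  have hn3 : (-Complex.I) ^ 3 = Complex.I := by rw [Odd.neg_pow (by decide), hI3, neg_neg]
  rw [hI3, hn3]
  generalize Complex.I = i at *
  generalize v 0 = x
  generalize v 1 = y
  linear_combination
    (-12 * (t * x * y) ^ 2 * (x ^ 2 + y ^ 2) ^ 2 - 2 * (i ^ 2 - 1) * (x ^ 2 + y ^ 2) ^ 4) * hI
    + 24 * x ^ 2 * y ^ 2 * (x ^ 4 + y ^ 4) * ht

lemma trinomialForm_fifth_sum {t : ℂ} (ht : t ^ 2 = 2) :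
    trinomialForm t 1 ^ 5 + trinomialForm t (-1) ^ 5 +
      C (-1) * trinomialForm t Complex.I ^ 5 + C (-1) * trinomialForm t (-Complex.I) ^ 5 = 0 := by
  refine MvPolynomial.funext fun v ↦ ?_
  simp only [map_add, map_mul, map_pow, map_zero, eval_C, eval_trinomialForm]
  have hI := Complex.I_sq
  have hI3 : Complex.I ^ 3 = -Complex.I := Complex.I_pow_three
  have hn3 : (-Complex.I) ^ 3 = Complex.I := by rw [Odd.neg_pow (by decide), hI3, neg_neg]
  rw [hI3, hn3]
  generalize Complex.I = i at *
  generalize v 0 = x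
  generalize v 1 = y
  linear_combination
    (-20 * (t * x * y) ^ 3 * (x ^ 2 + y ^ 2) ^ 2
      - 10 * t * x * y * (i ^ 2 - 1) * (x ^ 2 + y ^ 2) ^ 4) * hI
    + 40 * t * x ^ 3 * y ^ 3 * (x ^ 4 + y ^ 4) * ht

/-- If the `d`-th powers of three nonzero polynomials in one variable, `3 ≤ d`, satisfy a linear
dependence with nonzero coefficients, then the polynomials are proportional. -/
lemma Polynomial.exists_eq_smul_of_pow_sum_eq_zero {K : Type*} [Field K] {d : ℕ} (hd : 3 ≤ d)
    (hdK : (d : K) ≠ 0) {a b c : Polynomial K} {u v w : K} (ha : a ≠ 0) (hb : b ≠ 0) (hc : c ≠ 0)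
    (hu : u ≠ 0) (hv : v ≠ 0) (hw : w ≠ 0) (h : u • a ^ d + v • b ^ d + w • c ^ d = 0) :
    ∃ r : K, a = r • b := by
  have hd₀ : d ≠ 0 := by lia
  simp only [smul_eq_C_mul] at h
  obtain ⟨g, a', b', hg, hab, rfl, rfl⟩ :
      ∃ g a' b', g ≠ 0 ∧ IsCoprime a' b' ∧ a = g * a' ∧ b = g * b' := by
    classical
    have hg := gcd_ne_zero_of_right (a := a) hb
    exact ⟨gcd a b, a / gcd a b, b / gcd a b, hg, isCoprime_div_gcd_div_gcd hb,
      (EuclideanDomain.mul_div_cancel' hg (gcd_dvd_left a b)).symm,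
      (EuclideanDomain.mul_div_cancel' hg (gcd_dvd_right a b)).symm⟩
  obtain ⟨c', rfl⟩ : g ∣ c := by
    rw [← UniqueFactorizationMonoid.pow_dvd_pow_iff_dvd hd₀, ← (isUnit_C.2 hw.isUnit).dvd_mul_left]
    exact ⟨-(C u * a' ^ d + C v * b' ^ d), by linear_combination h⟩
  rw [mul_ne_zero_iff] at ha hb hc
  have h' : C u * a' ^ d + C v * b' ^ d + C w * c' ^ d = 0 :=
    mul_left_cancel₀ (pow_ne_zero d hg) (by linear_combination h)
  obtain ⟨ha', hb', -⟩ := flt_catalan hd₀ hd₀ hd₀ (by linarith [Nat.mul_le_mul_right (d * d) hd])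
    hdK hdK hdK ha.2 hb.2 hc.2 hab hu hv hw h'
  rw [natDegree_eq_zero] at ha' hb'
  obtain ⟨x, rfl⟩ := ha'
  obtain ⟨y, rfl⟩ := hb'
  have hy : y ≠ 0 := fun h ↦ hb.2 (by simp [h])
  refine ⟨x / y, ?_⟩
  rw [← mul_smul_comm, smul_C, smul_eq_mul, div_mul_cancel₀ _ hy]

/-- A binary form is determined by its dehomogenization. -/
lemma MvPolynomial.IsHomogeneous.eq_of_aeval_X_one_eq {R : Type*} [CommSemiring R] {n : ℕ}
    {p q : MvPolynomial (Fin 2) R} (hp : p.IsHomogeneous n) (hq : q.IsHomogeneous n)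
    (h : MvPolynomial.aeval ![Polynomial.X, (1 : Polynomial R)] p =
      MvPolynomial.aeval ![Polynomial.X, 1] q) : p = q := by
  rw [← Polynomial.homogenize_eq_of_isHomogeneous hp rfl,
    ← Polynomial.homogenize_eq_of_isHomogeneous hq rfl, h]

lemma not_existsWSet_three {k d : ℕ} (hd : 3 ≤ d) : ¬ ExistsWSet k 3 d := by
  rintro ⟨f, lam, hf, hf₀, hprop, hlam, hsum⟩
  have hne (i) : aeval ![Polynomial.X, (1 : Polynomial ℂ)] (f i) ≠ 0 := fun h ↦
    hf₀ i <| (hf i).eq_of_aeval_X_one_eq (isHomogeneous_zero _ _ _) (by rw [h, map_zero])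
  have hsum' := congrArg (aeval ![Polynomial.X, (1 : Polynomial ℂ)]) hsum
  simp only [Fin.sum_univ_three, map_add, map_smul, map_pow, map_zero] at hsum'
  obtain ⟨r, hr⟩ := Polynomial.exists_eq_smul_of_pow_sum_eq_zero hd
    (Nat.cast_ne_zero.2 (by lia)) (hne 0) (hne 1) (hne 2) (hlam 0) (hlam 1) (hlam 2) hsum'
  refine hprop 0 1 (by decide) r ((hf 0).eq_of_aeval_X_one_eq ?_ (by rw [hr, map_smul]))
  rw [smul_eq_C_mul]
  exact (hf 1).C_mul r

/-- For `d ∈ {3,4,5}` and `k ≥ 2`, a `𝒲_k(4,d)` set exists but no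
`𝒲_k(3,d)` set exists; hence `Φ_k(d) = 4` for `d = 3, 4, 5` and `k ≥ 2`. -/
theorem Phi_eq_four_for_d_three_four_five (d k : ℕ)
    (hd : d = 3 ∨ d = 4 ∨ d = 5) (hk : 2 ≤ k) :
    ExistsWSet k 4 d ∧ ¬ ExistsWSet k 3 d := by
  refine ⟨?_, not_existsWSet_three (by lia)⟩
  have sqrt_exists (z : ℂ) (hz : z ≠ 0) : ∃ t : ℂ, t ≠ 0 ∧ t ^ 2 = z := by
    obtain ⟨t, ht⟩ := IsAlgClosed.exists_pow_nat_eq z two_pos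
    exact ⟨t, fun h ↦ hz (by simp [← ht, h]), ht⟩
  rcases hd with rfl | rfl | rfl
  · obtain ⟨t, ht₀, ht⟩ := sqrt_exists 6 (by norm_num)
    exact existsWSet_four_of_trinomialForm hk ht₀ one_ne_zero (trinomialForm_cube_sum ht)
  · obtain ⟨t, ht₀, ht⟩ := sqrt_exists (2 / 3) (by norm_num)
    exact existsWSet_four_of_trinomialForm hk ht₀ (by norm_num) (trinomialForm_fourth_sum ht)
  · obtain ⟨t, ht₀, ht⟩ := sqrt_exists 2 (by norm_num)
    exact existsWSet_four_of_trinomialForm hk ht₀ (by norm_num) (trinomialForm_fifth_sum ht)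
end

section
/- Suppose f_1, f_2, f_3, f_4 are nonzero pairwise non-proportional binary quadratic forms over ℂ (homogeneous of degree 2 in ℂ[x,y]), d ≥ 3, and λ_1, …, λ_4 ∈ ℂ are nonzero scalars with λ_1 f_1^d + λ_2 f_2^d + λ_3 f_3^d + λ_4 f_4^d = 0. Then d ≤ 5. (Equivalently, Φ_2(d) ≥ 5 for d ≥ 6.) -/
open MvPolynomial Finset

/-- The dehomogenization at `y = 1` of the binary quadratic form `a x² + b x y + c y²`. -/
noncomputable def quadPoly (a b c : ℂ) : Polynomial ℂ :=
  Polynomial.C a * Polynomial.X ^ 2 + Polynomial.C b * Polynomial.X + Polynomial.C c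

lemma quadPoly_eval (a b c x : ℂ) : (quadPoly a b c).eval x = a * x ^ 2 + b * x + c := by
  simp [quadPoly]

lemma derivative_quadPoly (a b c : ℂ) :
    (quadPoly a b c).derivative = Polynomial.C (2 * a) * Polynomial.X + Polynomial.C b := by
  simp only [quadPoly, Polynomial.derivative_add, Polynomial.derivative_C_mul,
    Polynomial.derivative_C, Polynomial.derivative_X_sq, Polynomial.derivative_X, map_mul]
  ring

/-- Differentiating a linear relation between powers. -/
lemma sum_mul_pow_derivative {ι : Type*} [Fintype ι] (G F : ι → Polynomial ℂ) (n : ℕ)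
    (h : ∑ i, G i * F i ^ (n + 1) = 0) :
    ∑ i, ((G i).derivative * F i + (n + 1) * G i * (F i).derivative) * F i ^ n = 0 := by
  have h' := congrArg Polynomial.derivative h
  rw [Polynomial.derivative_sum, Polynomial.derivative_zero] at h'
  rw [← h']
  refine Finset.sum_congr rfl fun i _ => ?_
  simp [Polynomial.derivative_mul, Polynomial.derivative_pow]
  ring

/-- The first and second derivatives of a linear relation between powers. -/
lemma sum_pow_derivatives {ι : Type*} [Fintype ι] (μ : ι → ℂ) (F : ι → Polynomial ℂ) (n : ℕ)
    (h : ∑ i, Polynomial.C (μ i) * F i ^ (n + 2) = 0) :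
    ∑ i, Polynomial.C (μ i) * F i ^ n * (F i * (F i).derivative) = 0 ∧
    ∑ i, Polynomial.C (μ i) * F i ^ n *
      ((n + 1) * (F i).derivative ^ 2 + F i * (F i).derivative.derivative) = 0 := by
  have h1 := sum_mul_pow_derivative (fun i => Polynomial.C (μ i)) F (n + 1) h
  have hn : ((n : Polynomial ℂ) + 2) ≠ 0 := by
    have : ((n + 2 : ℕ) : Polynomial ℂ) ≠ 0 := Nat.cast_ne_zero.2 (by omega)
    exact_mod_cast this
  have h2 : ∑ i, Polynomial.C (μ i) * (F i).derivative * F i ^ (n + 1) = 0 := by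
    refine (mul_eq_zero.1 (?_ : ((n : Polynomial ℂ) + 2) * _ = 0)).resolve_left hn
    rw [← h1, Finset.mul_sum]
    refine Finset.sum_congr rfl fun i _ => ?_
    simp
    ring
  constructor
  · rw [← h2]
    exact Finset.sum_congr rfl fun i _ => by ring
  · rw [← sum_mul_pow_derivative (fun i => Polynomial.C (μ i) * (F i).derivative) F n h2]
    refine Finset.sum_congr rfl fun i _ => ?_
    simp [Polynomial.derivative_mul]
    ring

/-- For `f = a x² + b x y + c y²`, the second partials of `f ^ (n + 2)` are `(n + 2) f ^ n` times
the quadratic forms with dehomogenizations `hessXX`, `hessXY`, `hessYY`. -/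
noncomputable def hessXX (n : ℕ) (a b c : ℂ) : Polynomial ℂ :=
  quadPoly ((4 * n + 6) * a ^ 2) ((4 * n + 6) * a * b) ((n + 1) * b ^ 2 + 2 * a * c)

/-- See `hessXX`. -/
noncomputable def hessXY (n : ℕ) (a b c : ℂ) : Polynomial ℂ :=
  quadPoly ((2 * n + 3) * a * b) ((n + 2) * b ^ 2 + (4 * n + 4) * a * c) ((2 * n + 3) * b * c)

/-- See `hessXX`. -/
noncomputable def hessYY (n : ℕ) (a b c : ℂ) : Polynomial ℂ :=
  quadPoly ((n + 1) * b ^ 2 + 2 * a * c) ((4 * n + 6) * b * c) ((4 * n + 6) * c ^ 2)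

/-- A linear relation between powers of quadratic forms, differentiated twice. -/
lemma sum_hess {ι : Type*} [Fintype ι] (μ a b c : ι → ℂ) (n : ℕ)
    (h : ∑ i, Polynomial.C (μ i) * quadPoly (a i) (b i) (c i) ^ (n + 2) = 0) :
    ∑ i, Polynomial.C (μ i) * quadPoly (a i) (b i) (c i) ^ n * hessXX n (a i) (b i) (c i) = 0 ∧
    ∑ i, Polynomial.C (μ i) * quadPoly (a i) (b i) (c i) ^ n * hessXY n (a i) (b i) (c i) = 0 ∧
    ∑ i, Polynomial.C (μ i) * quadPoly (a i) (b i) (c i) ^ n * hessYY n (a i) (b i) (c i) = 0 := by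
  obtain ⟨h1, h2⟩ := sum_pow_derivatives μ _ n h
  have hA : ∑ i, Polynomial.C (μ i) * quadPoly (a i) (b i) (c i) ^ n *
      hessXX n (a i) (b i) (c i) = 0 := by
    rw [← h2]
    refine Finset.sum_congr rfl fun i _ => ?_
    rw [derivative_quadPoly, Polynomial.derivative_add, Polynomial.derivative_C_mul,
      Polynomial.derivative_X, Polynomial.derivative_C]
    simp only [hessXX, quadPoly, map_add, map_mul, map_pow, map_natCast, map_ofNat, map_one]
    ring
  have hB : ∑ i, Polynomial.C (μ i) * quadPoly (a i) (b i) (c i) ^ n *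
      hessXY n (a i) (b i) (c i) = 0 := by
    have := congrArg₂ (fun p q : Polynomial ℂ => (2 * (n : Polynomial ℂ) + 3) * p - Polynomial.X * q) h1 hA
    simp only [Finset.mul_sum, ← Finset.sum_sub_distrib, mul_zero, sub_zero] at this
    rw [← this]
    refine Finset.sum_congr rfl fun i _ => ?_
    rw [derivative_quadPoly]
    simp only [hessXX, hessXY, quadPoly, map_add, map_mul, map_pow, map_natCast, map_ofNat, map_one]
    ring
  refine ⟨hA, hB, ?_⟩
  have := congrArg₂ (fun p q : Polynomial ℂ => (2 * (n : Polynomial ℂ) + 3) * p - Polynomial.X * q)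
    (congrArg₂ (fun p q : Polynomial ℂ => 2 * p - Polynomial.X * q) h h1) hB
  simp only [Finset.mul_sum, ← Finset.sum_sub_distrib, mul_zero, sub_zero] at this
  rw [← this]
  refine Finset.sum_congr rfl fun i _ => ?_
  rw [derivative_quadPoly]
  simp only [hessXY, hessYY, quadPoly, map_add, map_mul, map_pow, map_natCast, map_ofNat, map_one]
  ring

/-- Powers of pairwise independent linear forms of degree at least three satisfy no relation with
four terms. -/
lemma linear_pow_relation (p q μ : Fin 4 → ℂ) (n : ℕ)
    (hpq : ∀ i, i ≠ 0 → p 0 * q i ≠ p i * q 0)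
    (h : ∑ i, Polynomial.C (μ i) *
      (Polynomial.C (p i) * Polynomial.X + Polynomial.C (q i)) ^ (n + 3) = 0) : μ 0 = 0 := by
  set L : Fin 4 → Polynomial ℂ := fun i => Polynomial.C (p i) * Polynomial.X + Polynomial.C (q i)
    with hL
  have step : ∀ (m : ℕ) (ν : Fin 4 → ℂ) (j : Fin 4),
      ∑ i, Polynomial.C (ν i) * L i ^ (m + 1) = 0 →
      ∑ i, Polynomial.C (ν i * (p i * q j - p j * q i)) * L i ^ m = 0 := by
    intro m ν j hν
    have h1 := sum_mul_pow_derivative (fun i => Polynomial.C (ν i)) L m hν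
    have hn : ((m : Polynomial ℂ) + 1) ≠ 0 := by
      have : ((m + 1 : ℕ) : Polynomial ℂ) ≠ 0 := Nat.cast_ne_zero.2 (by omega)
      exact_mod_cast this
    refine (mul_eq_zero.1 (?_ : ((m : Polynomial ℂ) + 1) * _ = 0)).resolve_left hn
    have := congrArg₂ (fun P Q => L j * P - (m + 1) * Polynomial.C (p j) * Q) h1 hν
    simp only [Finset.mul_sum, ← Finset.sum_sub_distrib, mul_zero, sub_zero] at this
    rw [← this, Finset.mul_sum]
    refine Finset.sum_congr rfl fun i _ => ?_
    simp [hL]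
    ring
  have h3 := step n _ 3 (step (n + 1) _ 2 (step (n + 2) μ 1 h))
  have hL0 : L 0 ≠ 0 := by
    intro h0
    have e0 : (L 0).coeff 0 = 0 := by rw [h0]; simp
    have e1 : (L 0).coeff 1 = 0 := by rw [h0]; simp
    simp [hL] at e0 e1
    exact hpq 1 (by decide) (by rw [e0, e1]; ring)
  rw [Fin.sum_univ_four] at h3
  have h1 := sub_ne_zero.2 (hpq 1 (by decide))
  have h2 := sub_ne_zero.2 (hpq 2 (by decide))
  have h3' := sub_ne_zero.2 (hpq 3 (by decide))
  simpa [-map_mul, -map_sub, hL0, h1, h2, h3'] using h3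

/-- The minors whose vanishing expresses that two quadratic forms are proportional. -/
def MinorsVanish (a b c a' b' c' : ℂ) : Prop :=
  a * b' = a' * b ∧ a * c' = a' * c ∧ b * c' = b' * c

/-- In a relation with four terms, two of the forms have no common zero at `(0, 1)`. -/
lemma no_common_zero (a b c μ : Fin 4 → ℂ) (n : ℕ) (hn : 1 ≤ n) (hμ : ∀ i, μ i ≠ 0)
    (hnp : ∀ i j, i ≠ j → ¬ MinorsVanish (a i) (b i) (c i) (a j) (b j) (c j))
    (h : ∑ i, Polynomial.C (μ i) * quadPoly (a i) (b i) (c i) ^ (n + 2) = 0)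
    (h0 : c 0 = 0) (h1 : c 1 = 0) : False := by
  obtain ⟨hA, hB, hC⟩ := sum_hess μ a b c n h
  have eA := congrArg (Polynomial.eval 0) hA
  have eB := congrArg (Polynomial.eval 0) hB
  have eC := congrArg (Polynomial.eval 0) hC
  have hn0 : n ≠ 0 := by omega
  simp [Fin.sum_univ_four, quadPoly_eval, hessXX, hessXY, hessYY, h0, h1, hn0] at eA eB eC
  have k1 : (2 * (n : ℂ) + 3) ≠ 0 := by
    have : ((2 * n + 3 : ℕ) : ℂ) ≠ 0 := Nat.cast_ne_zero.2 (by omega)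
    exact_mod_cast this
  by_cases h2 : c 2 = 0
  · have h3 : c 3 = 0 := by
      by_contra h3
      have : (4 * (n : ℂ) + 6) ≠ 0 := by
        have := mul_ne_zero two_ne_zero k1; intro h'; apply this; linear_combination h'
      simp [h2, hn0, hμ, h3, this] at eC
    have hc : ∀ i, c i = 0 := by intro i; fin_cases i <;> assumption
    refine hμ 0 (linear_pow_relation a b μ (n - 1) (fun i hi hab => hnp 0 i hi.symm ?_) ?_)
    · exact ⟨hab, by simp [hc], by simp [hc]⟩
    · have hX : (Polynomial.X : Polynomial ℂ) ^ (n + 2) ≠ 0 := pow_ne_zero _ Polynomial.X_ne_zero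
      refine (mul_eq_zero.1 (?_ : (Polynomial.X : Polynomial ℂ) ^ (n + 2) * _ = 0)).resolve_left hX
      rw [← h, Finset.mul_sum, show n - 1 + 3 = n + 2 by omega]
      refine Finset.sum_congr rfl fun i _ => ?_
      rw [mul_left_comm, ← mul_pow, hc i]
      congr 2
      simp [quadPoly]
      ring
  · have h3 : c 3 ≠ 0 := by
      intro h3
      have : (4 * (n : ℂ) + 6) ≠ 0 := by
        have := mul_ne_zero two_ne_zero k1; intro h'; apply this; linear_combination h'
      simp [h3, hn0, hμ, h2, this] at eC
    set α := μ 2 * c 2 ^ n with hα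
    set β := μ 3 * c 3 ^ n with hβ
    have hα0 : α ≠ 0 := mul_ne_zero (hμ 2) (pow_ne_zero _ h2)
    have eC' : α * c 2 ^ 2 + β * c 3 ^ 2 = 0 := by
      refine (mul_eq_zero.1 (?_ : (2 * (2 * (n : ℂ) + 3)) * _ = 0)).resolve_left
        (mul_ne_zero two_ne_zero k1)
      linear_combination eC
    have eB' : α * b 2 * c 2 + β * b 3 * c 3 = 0 := by
      refine (mul_eq_zero.1 (?_ : (2 * (n : ℂ) + 3) * _ = 0)).resolve_left k1
      linear_combination eB
    have hbc : b 2 * c 3 = b 3 * c 2 := by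
      have : α * c 2 * (b 2 * c 3 - b 3 * c 2) = 0 := by
        linear_combination c 3 * eB' - b 3 * eC'
      exact sub_eq_zero.1 ((mul_eq_zero.1 this).resolve_left (mul_ne_zero hα0 h2))
    have hac : a 2 * c 3 = a 3 * c 2 := by
      have e2 : α * b 2 ^ 2 + β * b 3 ^ 2 = 0 := by
        have : c 2 ^ 2 * (α * b 2 ^ 2 + β * b 3 ^ 2) = 0 := by
          linear_combination b 2 ^ 2 * eC' - β * (b 2 * c 3 + b 3 * c 2) * hbc
        exact (mul_eq_zero.1 this).resolve_left (pow_ne_zero _ h2)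
      have e3 : α * a 2 * c 2 + β * a 3 * c 3 = 0 := by
        linear_combination (1 / 2) * eA - (n + 1) / 2 * e2
      have : α * c 2 * (a 2 * c 3 - a 3 * c 2) = 0 := by
        linear_combination c 3 * e3 - a 3 * eC'
      exact sub_eq_zero.1 ((mul_eq_zero.1 this).resolve_left (mul_ne_zero hα0 h2))
    refine hnp 2 3 (by decide) ⟨?_, hac, hbc⟩
    have : c 2 * (a 2 * b 3 - a 3 * b 2) = 0 := by
      linear_combination -a 2 * hbc + b 2 * hac
    exact sub_eq_zero.1 ((mul_eq_zero.1 this).resolve_left h2)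

/-- The vanishing at `(0, 1)` of the determinant formed by the second partials of the powers of
`x y` and of two further forms in a relation with four terms. -/
lemma middle_coeff_proportional (a b c μ : Fin 4 → ℂ) (n : ℕ) (hn : 4 ≤ n) (hμ : μ 0 ≠ 0)
    (h : ∑ i, Polynomial.C (μ i) * quadPoly (a i) (b i) (c i) ^ (n + 2) = 0)
    (ha0 : a 0 = 0) (hb0 : b 0 = 1) (hc0 : c 0 = 0) (hc : ∀ i, i ≠ 0 → c i ≠ 0) (ha3 : a 3 ≠ 0) :
    b 1 * c 2 = b 2 * c 1 := by
  obtain ⟨hA, hB, hC⟩ := sum_hess μ a b c n h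
  rw [Fin.sum_univ_four] at hA hB hC
  set F : Fin 4 → Polynomial ℂ := fun i => quadPoly (a i) (b i) (c i) with hF
  set A : Fin 4 → Polynomial ℂ := fun i => hessXX n (a i) (b i) (c i) with hAd
  set B : Fin 4 → Polynomial ℂ := fun i => hessXY n (a i) (b i) (c i) with hBd
  set E : Fin 4 → Polynomial ℂ := fun i => hessYY n (a i) (b i) (c i) with hEd
  set D : Fin 4 → Polynomial ℂ := fun k => A k * (B 1 * E 2 - B 2 * E 1)
    - B k * (A 1 * E 2 - A 2 * E 1) + E k * (A 1 * B 2 - A 2 * B 1) with hD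
  have cramer : Polynomial.C (μ 0) * F 0 ^ n * D 0 + Polynomial.C (μ 3) * F 3 ^ n * D 3 = 0 := by
    linear_combination (B 1 * E 2 - B 2 * E 1) * hA - (A 1 * E 2 - A 2 * E 1) * hB
      + (A 1 * B 2 - A 2 * B 1) * hC
  have hF0 : F 0 = Polynomial.X := by simp [hF, quadPoly, ha0, hb0, hc0]
  have hcop : IsCoprime (F 3 ^ n) (Polynomial.C (μ 0) * F 0 ^ n) := by
    have hu : IsUnit (Polynomial.C (μ 0)) := Polynomial.isUnit_C.2 hμ.isUnit
    refine (isCoprime_mul_unit_left_right hu _ _).2 (IsCoprime.pow ?_)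
    refine ⟨Polynomial.C (c 3)⁻¹,
      -(Polynomial.C (c 3)⁻¹ * (Polynomial.C (a 3) * Polynomial.X + Polynomial.C (b 3))), ?_⟩
    have : Polynomial.C (c 3)⁻¹ * Polynomial.C (c 3) = 1 := by
      rw [← Polynomial.C_mul, inv_mul_cancel₀ (hc 3 (by decide)), Polynomial.C_1]
    rw [hF0]
    simp only [hF, quadPoly]
    linear_combination this
  have hdvd : F 3 ^ n ∣ D 0 := by
    refine hcop.dvd_of_dvd_mul_left ⟨-(Polynomial.C (μ 3) * D 3), ?_⟩
    linear_combination cramer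
  have hdeg : ∀ x y z : ℂ, (quadPoly x y z).natDegree ≤ 2 := by
    intro x y z; unfold quadPoly; compute_degree
  have hD0 : D 0 = 0 := by
    by_contra hne
    have h1 := Polynomial.natDegree_le_of_dvd hdvd hne
    have h2 : (F 3).natDegree = 2 := by
      simp only [hF, quadPoly]; compute_degree!
    have hmul : ∀ P Q : Polynomial ℂ, ∀ k l : ℕ, P.natDegree ≤ k → Q.natDegree ≤ l →
        (P * Q).natDegree ≤ k + l := fun P Q k l => Polynomial.natDegree_mul_le_of_le
    have h3 : (D 0).natDegree ≤ 2 + (2 + 2) := by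
      have hsub : ∀ P Q : Polynomial ℂ, ∀ k : ℕ, P.natDegree ≤ k → Q.natDegree ≤ k →
          (P - Q).natDegree ≤ k := fun P Q k hP hQ =>
        (Polynomial.natDegree_sub_le P Q).trans (max_le hP hQ)
      refine Polynomial.natDegree_add_le_of_degree_le (hsub _ _ _ ?_ ?_) ?_
      all_goals
        refine hmul _ _ _ _ (hdeg _ _ _) (hsub _ _ _ ?_ ?_)
      all_goals exact hmul _ _ _ _ (hdeg _ _ _) (hdeg _ _ _)
    rw [Polynomial.natDegree_pow, h2] at h1
    omega
  have e := congrArg (Polynomial.eval 0) hD0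
  simp [hD, hAd, hBd, hEd, hessXX, hessXY, hessYY, quadPoly_eval, ha0, hb0, hc0] at e
  have k0 : ((n : ℂ) + 1) ≠ 0 := Nat.cast_add_one_ne_zero n
  have k1 : (2 * (n : ℂ) + 3) ≠ 0 := by
    have : ((2 * n + 3 : ℕ) : ℂ) ≠ 0 := Nat.cast_ne_zero.2 (by omega)
    exact_mod_cast this
  have e' : (2 * (2 * (n : ℂ) + 3) ^ 2 * (c 1 * c 2)) * (b 1 * c 2 - b 2 * c 1) = 0 := by
    rcases e with e | e
    · exact absurd e k0
    · linear_combination e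
  refine sub_eq_zero.1 ((mul_eq_zero.1 e').resolve_left ?_)
  exact mul_ne_zero (mul_ne_zero two_ne_zero (pow_ne_zero _ k1))
    (mul_ne_zero (hc 1 (by decide)) (hc 2 (by decide)))

/-- A power of `x y` is not a combination of three powers of forms `a x² + c y²`. -/
lemma diagonal_relation (a c μ : Fin 4 → ℂ) (n : ℕ) (hn : 3 ≤ n) (hμ : μ 1 ≠ 0)
    (b : Fin 4 → ℂ)
    (h : ∑ i, Polynomial.C (μ i) * quadPoly (a i) (b i) (c i) ^ (n + 2) = 0)
    (ha0 : a 0 = 0) (hb0 : b 0 = 1) (hc0 : c 0 = 0) (hb : ∀ i, i ≠ 0 → b i = 0)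
    (hc : c 1 ≠ 0) (h12 : a 1 * c 2 ≠ a 2 * c 1) (h13 : a 1 * c 3 ≠ a 3 * c 1) : False := by
  obtain ⟨hA, -, hC⟩ := sum_hess μ a b c n h
  obtain ⟨l, rfl⟩ : ∃ l, n = l + 3 := ⟨n - 3, by omega⟩
  have h2 := sum_mul_pow_derivative _ _ (l + 1) (sum_mul_pow_derivative
    (fun i => Polynomial.C (μ i) * hessXX (l + 3) (a i) (b i) (c i))
    (fun i => quadPoly (a i) (b i) (c i)) (l + 2) (by
      rw [← hA]
      exact Finset.sum_congr rfl fun i _ => by ring))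
  have e0 := congrArg (Polynomial.eval 0) hC
  have e1 := congrArg (Polynomial.eval 0) hA
  have e2 := congrArg (Polynomial.eval 0) h2
  simp [Fin.sum_univ_four, quadPoly_eval, hessXX, hessYY, ha0, hb0, hc0, hb,
    derivative_quadPoly, Polynomial.derivative_mul] at e0 e1 e2
  set t : Fin 4 → ℂ := fun i => μ i * c i ^ (l + 3) with ht
  have k0 : ((4 * (l + 3) + 6 : ℕ) : ℂ) ≠ 0 := Nat.cast_ne_zero.2 (by omega)
  have k2 : ((12 * (l + 4) : ℕ) : ℂ) ≠ 0 := Nat.cast_ne_zero.2 (by omega)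
  have f0 : t 1 * c 1 ^ 2 + t 2 * c 2 ^ 2 + t 3 * c 3 ^ 2 = 0 := by
    refine (mul_eq_zero.1 (?_ : ((4 * (l + 3) + 6 : ℕ) : ℂ) * _ = 0)).resolve_left k0
    push_cast
    linear_combination e0
  have f1 : t 1 * a 1 * c 1 + t 2 * a 2 * c 2 + t 3 * a 3 * c 3 = 0 := by
    linear_combination (1 / 2) * e1
  have f2 : t 1 * a 1 ^ 2 + t 2 * a 2 ^ 2 + t 3 * a 3 ^ 2 = 0 := by
    refine (mul_eq_zero.1 (?_ : ((12 * (l + 4) : ℕ) : ℂ) * _ = 0)).resolve_left k2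
    push_cast
    linear_combination e2
  have : t 1 * ((a 1 * c 2 - a 2 * c 1) * (a 1 * c 3 - a 3 * c 1)) = 0 := by
    linear_combination c 2 * c 3 * f2 - (c 2 * a 3 + a 2 * c 3) * f1 + a 2 * a 3 * f0
  exact mul_ne_zero (mul_ne_zero hμ (pow_ne_zero _ hc))
    (mul_ne_zero (sub_ne_zero.2 h12) (sub_ne_zero.2 h13)) this

lemma sum_quadPoly_eq_zero {ι : Type*} [Fintype ι] (a b c μ : ι → ℂ) (d : ℕ)
    (H : ∀ x y : ℂ, ∑ i, μ i * (a i * x ^ 2 + b i * x * y + c i * y ^ 2) ^ d = 0) :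
    ∑ i, Polynomial.C (μ i) * quadPoly (a i) (b i) (c i) ^ d = 0 := by
  refine Polynomial.funext fun x => ?_
  rw [Polynomial.eval_zero, ← H x 1, Polynomial.eval_finsetSum]
  refine Finset.sum_congr rfl fun i _ => ?_
  simp [quadPoly_eval]

/-- In a relation with four terms, no form shares the zero `(0, 1)` of the first form. -/
lemma coeff_ne_zero (a b c μ : Fin 4 → ℂ) (n : ℕ) (hn : 1 ≤ n) (hμ : ∀ i, μ i ≠ 0)
    (hnp : ∀ i j, i ≠ j → ¬ MinorsVanish (a i) (b i) (c i) (a j) (b j) (c j))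
    (h : ∑ i, Polynomial.C (μ i) * quadPoly (a i) (b i) (c i) ^ (n + 2) = 0)
    (h0 : c 0 = 0) (i : Fin 4) (hi : i ≠ 0) : c i ≠ 0 := by
  intro hci
  let e : Equiv.Perm (Fin 4) := Equiv.swap 1 i
  refine no_common_zero (a ∘ e) (b ∘ e) (c ∘ e) (μ ∘ e) n hn (fun _ => hμ _)
    (fun j k hjk => hnp _ _ (e.injective.ne hjk)) ?_ ?_ ?_
  · rw [← h]
    exact Equiv.sum_comp e fun i => Polynomial.C (μ i) * quadPoly (a i) (b i) (c i) ^ (n + 2)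
  · simpa [e, Equiv.swap_apply_of_ne_of_ne (show (0 : Fin 4) ≠ 1 by decide) hi.symm] using h0
  · simpa [e] using hci

lemma no_relation_of_xy (a b c μ : Fin 4 → ℂ) (n : ℕ) (hn : 4 ≤ n) (hμ : ∀ i, μ i ≠ 0)
    (hnp : ∀ i j, i ≠ j → ¬ MinorsVanish (a i) (b i) (c i) (a j) (b j) (c j))
    (H : ∀ x y : ℂ, ∑ i, μ i * (a i * x ^ 2 + b i * x * y + c i * y ^ 2) ^ (n + 2) = 0)
    (ha0 : a 0 = 0) (hb0 : b 0 = 1) (hc0 : c 0 = 0) : False := by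
  have h := sum_quadPoly_eq_zero a b c μ _ H
  have h' := sum_quadPoly_eq_zero c b a μ (n + 2) (fun x y => by
    rw [← H y x]
    exact Finset.sum_congr rfl fun i _ => by ring)
  have hc := coeff_ne_zero a b c μ n (by omega) hμ hnp h hc0
  have ha := coeff_ne_zero c b a μ n (by omega) hμ (fun i j hij hm => hnp i j hij
    ⟨by linear_combination -hm.2.2, by linear_combination -hm.2.1,
      by linear_combination -hm.1⟩) h' ha0
  have key : ∀ a c : Fin 4 → ℂ,
      ∑ i, Polynomial.C (μ i) * quadPoly (a i) (b i) (c i) ^ (n + 2) = 0 →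
      a 0 = 0 → c 0 = 0 → (∀ i, i ≠ 0 → a i ≠ 0) → (∀ i, i ≠ 0 → c i ≠ 0) →
      b 1 * c 2 = b 2 * c 1 ∧ b 1 * c 3 = b 3 * c 1 := by
    intro a c h ha0 hc0 ha hc
    refine ⟨middle_coeff_proportional a b c μ n hn (hμ 0) h ha0 hb0 hc0 hc (ha 3 (by decide)), ?_⟩
    let e : Equiv.Perm (Fin 4) := Equiv.swap 2 3
    have e0 : e 0 = 0 := by decide
    refine middle_coeff_proportional (a ∘ e) (b ∘ e) (c ∘ e) (μ ∘ e) n hn (hμ _) ?_ ?_ ?_ ?_ ?_ ?_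
    · rw [← h]
      exact Equiv.sum_comp e fun i => Polynomial.C (μ i) * quadPoly (a i) (b i) (c i) ^ (n + 2)
    · simpa [e0] using ha0
    · simpa [e0] using hb0
    · simpa [e0] using hc0
    · exact fun i hi => hc _ fun hei => hi (e.injective (hei.trans e0.symm))
    · exact ha _ (by decide)
  obtain ⟨c2, c3⟩ := key a c h ha0 hc0 ha hc
  obtain ⟨a2, a3⟩ := key c a h' hc0 ha0 hc ha
  have minors : ∀ i, b 1 ≠ 0 → b 1 * c i = b i * c 1 → b 1 * a i = b i * a 1 →
      MinorsVanish (a 1) (b 1) (c 1) (a i) (b i) (c i) := by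
    intro i hb hci hai
    refine ⟨by linear_combination -hai, mul_left_cancel₀ hb ?_, hci⟩
    linear_combination a 1 * hci - c 1 * hai
  by_cases hb1 : b 1 = 0
  · have c1 := hc 1 (by decide)
    have hb2 : b 2 = 0 := by simpa [hb1, c1] using c2
    have hb3 : b 3 = 0 := by simpa [hb1, c1] using c3
    have hb : ∀ i, i ≠ 0 → b i = 0 := by
      intro i hi
      fin_cases i
      · exact absurd rfl hi
      all_goals assumption
    refine diagonal_relation a c μ n (by omega) (hμ 1) b h ha0 hb0 hc0 hb c1 ?_ ?_
    · exact fun hac => hnp 1 2 (by decide) ⟨by simp [hb1, hb2], hac, by simp [hb1, hb2]⟩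
    · exact fun hac => hnp 1 3 (by decide) ⟨by simp [hb1, hb3], hac, by simp [hb1, hb3]⟩
  · exact hnp 1 2 (by decide) (minors 2 hb1 c2 a2)

/-- A quadratic form that is not a square is a product of independent linear forms. -/
lemma exists_factorization (a b c : ℂ) (h : b ^ 2 ≠ 4 * a * c) :
    ∃ p q r s : ℂ, p * s - q * r ≠ 0 ∧ a = p * r ∧ b = p * s + q * r ∧ c = q * s := by
  by_cases ha : a = 0
  · refine ⟨0, 1, b, c, ?_, by simp [ha], by simp, by simp⟩
    have : b ≠ 0 := by rintro rfl; simp [ha] at h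
    simpa using this
  · obtain ⟨w, hw⟩ := IsAlgClosed.exists_pow_nat_eq (b ^ 2 - 4 * a * c) (n := 2) (by norm_num)
    have hw0 : w ≠ 0 := by
      rintro rfl
      exact h (by linear_combination -hw)
    refine ⟨a, (b + w) / 2, 1, (b - w) / (2 * a), ?_, by ring, by field_simp; ring, ?_⟩
    · have : a * ((b - w) / (2 * a)) - (b + w) / 2 * 1 = -w := by field_simp; ring
      rw [this]
      exact neg_ne_zero.2 hw0
    · field_simp
      linear_combination hw

lemma exists_sq_of_discrim (a b c : ℂ) (h : b ^ 2 = 4 * a * c) :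
    ∃ p q : ℂ, a = p ^ 2 ∧ b = 2 * p * q ∧ c = q ^ 2 := by
  by_cases ha : a = 0
  · obtain ⟨q, hq⟩ := IsAlgClosed.exists_pow_nat_eq c (n := 2) (by norm_num)
    have : b = 0 := by simpa [ha] using h
    exact ⟨0, q, by simp [ha], by simp [this], hq.symm⟩
  · obtain ⟨p, hp⟩ := IsAlgClosed.exists_pow_nat_eq a (n := 2) (by norm_num)
    have hp0 : p ≠ 0 := by rintro rfl; simp at hp; exact ha hp.symm
    refine ⟨p, b / (2 * p), hp.symm, by field_simp, ?_⟩
    field_simp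
    rw [hp]
    linear_combination -h

lemma no_relation_of_first_not_sq (a b c μ : Fin 4 → ℂ) (n : ℕ) (hn : 4 ≤ n) (hμ : ∀ i, μ i ≠ 0)
    (hnp : ∀ i j, i ≠ j → ¬ MinorsVanish (a i) (b i) (c i) (a j) (b j) (c j))
    (H : ∀ x y : ℂ, ∑ i, μ i * (a i * x ^ 2 + b i * x * y + c i * y ^ 2) ^ (n + 2) = 0)
    (h0 : b 0 ^ 2 ≠ 4 * a 0 * c 0) : False := by
  obtain ⟨p, q, r, s, hδ, hpa, hpb, hpc⟩ := exists_factorization _ _ _ h0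
  set δ := p * s - q * r with hδd
  let a' : Fin 4 → ℂ := fun i => (a i * s ^ 2 - b i * s * r + c i * r ^ 2) / δ ^ 2
  let b' : Fin 4 → ℂ := fun i =>
    (-2 * a i * s * q + b i * (p * s + q * r) - 2 * c i * r * p) / δ ^ 2
  let c' : Fin 4 → ℂ := fun i => (a i * q ^ 2 - b i * q * p + c i * p ^ 2) / δ ^ 2
  have ea : ∀ i, a i = a' i * p ^ 2 + b' i * (p * r) + c' i * r ^ 2 := by
    intro i; simp only [a', b', c']; field_simp; rw [hδd]; ring
  have eb : ∀ i, b i = a' i * (2 * p * q) + b' i * (p * s + q * r) + c' i * (2 * r * s) := by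
    intro i; simp only [a', b', c']; field_simp; rw [hδd]; ring
  have ec : ∀ i, c i = a' i * q ^ 2 + b' i * (q * s) + c' i * s ^ 2 := by
    intro i; simp only [a', b', c']; field_simp; rw [hδd]; ring
  refine no_relation_of_xy a' b' c' μ n hn hμ ?_ ?_ ?_ ?_ ?_
  · rintro i j hij ⟨m1, m2, m3⟩
    refine hnp i j hij ⟨?_, ?_, ?_⟩
    · rw [ea i, ea j, eb i, eb j]
      linear_combination (p ^ 2 * (p * s + q * r) - p * r * (2 * p * q)) * m1 +
        (p ^ 2 * (2 * r * s) - r ^ 2 * (2 * p * q)) * m2 +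
        (p * r * (2 * r * s) - r ^ 2 * (p * s + q * r)) * m3
    · rw [ea i, ea j, ec i, ec j]
      linear_combination (p ^ 2 * (q * s) - p * r * q ^ 2) * m1 +
        (p ^ 2 * s ^ 2 - r ^ 2 * q ^ 2) * m2 + (p * r * s ^ 2 - r ^ 2 * (q * s)) * m3
    · rw [eb i, eb j, ec i, ec j]
      linear_combination (2 * p * q * (q * s) - (p * s + q * r) * q ^ 2) * m1 +
        (2 * p * q * s ^ 2 - 2 * r * s * q ^ 2) * m2 +
        ((p * s + q * r) * s ^ 2 - 2 * r * s * (q * s)) * m3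
  · intro u v
    rw [← H ((s * u - q * v) / δ) ((p * v - r * u) / δ)]
    refine Finset.sum_congr rfl fun i _ => ?_
    congr 2
    simp only [a', b', c']
    field_simp
    ring
  · simp only [a', hpa, hpb, hpc]
    rw [div_eq_zero_iff]
    left
    ring
  · simp only [b', hpa, hpb, hpc]
    rw [div_eq_one_iff_eq (pow_ne_zero _ hδ), hδd]
    ring
  · simp only [c', hpa, hpb, hpc]
    rw [div_eq_zero_iff]
    left
    ring

lemma no_relation (a b c μ : Fin 4 → ℂ) (n : ℕ) (hn : 4 ≤ n) (hμ : ∀ i, μ i ≠ 0)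
    (hnp : ∀ i j, i ≠ j → ¬ MinorsVanish (a i) (b i) (c i) (a j) (b j) (c j))
    (H : ∀ x y : ℂ, ∑ i, μ i * (a i * x ^ 2 + b i * x * y + c i * y ^ 2) ^ (n + 2) = 0) :
    False := by
  by_cases hsq : ∀ i, b i ^ 2 = 4 * a i * c i
  · choose p q hp hpq hq using fun i => exists_sq_of_discrim _ _ _ (hsq i)
    refine hμ 0 (linear_pow_relation p q μ (2 * n + 1) (fun i hi hpqi => hnp 0 i hi.symm ?_) ?_)
    · unfold MinorsVanish
      rw [hp 0, hp i, hpq 0, hpq i, hq 0, hq i]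
      refine ⟨?_, ?_, ?_⟩
      · linear_combination 2 * p 0 * p i * hpqi
      · linear_combination (p 0 * q i + p i * q 0) * hpqi
      · linear_combination 2 * q 0 * q i * hpqi
    · rw [← sum_quadPoly_eq_zero a b c μ _ H]
      refine Finset.sum_congr rfl fun i _ => ?_
      rw [show 2 * n + 1 + 3 = 2 * (n + 2) by ring, pow_mul]
      congr 2
      simp only [quadPoly, hp i, hpq i, hq i, map_mul, map_pow, map_ofNat]
      ring
  · push Not at hsq
    obtain ⟨i, hi⟩ := hsq
    let e : Equiv.Perm (Fin 4) := Equiv.swap 0 i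
    refine no_relation_of_first_not_sq (a ∘ e) (b ∘ e) (c ∘ e) (μ ∘ e) n hn (fun _ => hμ _)
      (fun j k hjk => hnp _ _ (e.injective.ne hjk)) (fun x y => ?_) (by simpa [e] using hi)
    rw [← H x y]
    exact Equiv.sum_comp e fun i =>
      μ i * (a i * x ^ 2 + b i * x * y + c i * y ^ 2) ^ (n + 2)

lemma exists_eval_eq_of_isHomogeneous (f : MvPolynomial (Fin 2) ℂ) (hf : f.IsHomogeneous 2) :
    ∃ a b c : ℂ, ∀ w : Fin 2 → ℂ,
      eval w f = a * w 0 ^ 2 + b * w 0 * w 1 + c * w 1 ^ 2 := by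
  let m : ℕ × ℕ → Fin 2 →₀ ℕ := fun k => Finsupp.single 0 k.1 + Finsupp.single 1 k.2
  have m0 : ∀ k, m k 0 = k.1 := fun k => by simp [m]
  have m1 : ∀ k, m k 1 = k.2 := fun k => by simp [m]
  refine ⟨f.coeff (m (2, 0)), f.coeff (m (1, 1)), f.coeff (m (0, 2)), fun w => ?_⟩
  have hinj : Function.Injective m := fun k l hkl =>
    Prod.ext (by rw [← m0 k, hkl, m0]) (by rw [← m1 k, hkl, m1])
  have hsub : f.support ⊆ (Finset.HasAntidiagonal.antidiagonal 2).image m := by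
    intro t ht
    have hdeg := hf (mem_support_iff.1 ht)
    rw [Finsupp.weight_apply, Finsupp.sum_fintype _ _ (by simp), Fin.sum_univ_two] at hdeg
    refine Finset.mem_image.2 ⟨(t 0, t 1), by simpa using hdeg, ?_⟩
    ext i
    fin_cases i
    · exact m0 _
    · exact m1 _
  rw [eval_eq', Finset.sum_subset hsub, Finset.sum_image hinj.injOn]
  · simp [Finset.Nat.sum_antidiagonal_eq_sum_range_succ_mk, Finset.sum_range_succ, m0, m1]
    ring
  · intro t _ ht
    simp [notMem_support_iff.1 ht]

/-- If `f_1, f_2, f_3, f_4` are nonzero, pairwise non-proportional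
binary quadratic forms over `ℂ`, `d ≥ 3`, and `λ_1 f_1^d + ⋯ + λ_4 f_4^d = 0`
with all `λ_i ≠ 0`, then `d ≤ 5` (equivalently `Φ_2(d) ≥ 5` for `d ≥ 6`). -/
theorem W2_four_set_implies_d_le_five (d : ℕ) (hd : 3 ≤ d)
    (f : Fin 4 → MvPolynomial (Fin 2) ℂ) (lam : Fin 4 → ℂ)
    (hhom : ∀ i, (f i).IsHomogeneous 2)
    (hne : ∀ i, f i ≠ 0)
    (hprop : ∀ i j, i ≠ j → ∀ c : ℂ, f i ≠ c • f j)
    (hlam : ∀ i, lam i ≠ 0)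
    (hdep : ∑ i, lam i • f i ^ d = 0) :
    d ≤ 5 := by
  by_contra! hd6
  obtain ⟨n, rfl⟩ : ∃ n, d = n + 2 := ⟨d - 2, by omega⟩
  choose a b c habc using fun i => exists_eval_eq_of_isHomogeneous (f i) (hhom i)
  refine no_relation a b c lam n (by omega) hlam ?_ fun x y => ?_
  · rintro i j hij ⟨h1, h2, h3⟩
    have smul_eq : ∀ s, a i = s * a j → b i = s * b j → c i = s * c j → False := by
      intro s ha hb hc
      refine hprop i j hij s (MvPolynomial.funext fun w => ?_)
      rw [smul_eval, habc, habc, ha, hb, hc]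
      ring
    by_cases ha : a j = 0
    · by_cases hb : b j = 0
      · by_cases hc : c j = 0
        · exact hne j (MvPolynomial.funext fun w => by simp [habc, ha, hb, hc])
        · refine smul_eq (c i / c j) ?_ ?_ ?_ <;> field_simp
          · linear_combination h2
          · linear_combination h3
      · refine smul_eq (b i / b j) ?_ ?_ ?_ <;> field_simp
        · linear_combination h1
        · linear_combination -h3
    · refine smul_eq (a i / a j) ?_ ?_ ?_ <;> field_simp
      · linear_combination -h1
      · linear_combination -h2
  · have := congrArg (eval ![x, y]) hdep
    simpa [smul_eval, habc] using this
end

section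
/- Let n ≥ 1 and suppose p, q, r ∈ ℂ[x_1, …, x_n] satisfy p² + q² = r². Then there exist f, g, h ∈ ℂ[x_1, …, x_n] such that p = f(g² − h²), q = f(2gh), and r = f(g² + h²). -/
open MvPolynomial

/-- In a GCD domain in which every unit is a square, two elements whose product is a square are,
up to a common factor, squares. -/
theorem exists_eq_mul_sq_of_mul_eq_sq {R : Type*} [CommRing R] [IsDomain R] [GCDMonoid R]
    (hsq : ∀ u : R, IsUnit u → IsSquare u) {a b c : R} (h : a * b = c ^ 2) :
    ∃ d x y : R, a = d * x ^ 2 ∧ b = d * y ^ 2 ∧ c = d * (x * y) := by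
  have square_of_coprime {s t w : R} (hu : IsUnit (gcd s t)) (hst : s * t = w ^ 2) :
      ∃ x, s = x ^ 2 := by
    obtain ⟨x, u, hx⟩ := exists_associated_pow_of_mul_eq_pow hu hst
    obtain ⟨v, hv⟩ := hsq u u.isUnit
    exact ⟨x * v, by rw [← hx, hv]; ring⟩
  obtain ⟨s, t, ha, hb, hu⟩ := extract_gcd a b
  generalize gcd a b = d at ha hb
  subst ha hb
  obtain rfl | hd := eq_or_ne d 0
  · exact ⟨0, 0, 0, by simp, by simp, by simpa using h.symm⟩
  obtain ⟨w, rfl⟩ : d ∣ c :=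
    (IsIntegrallyClosed.pow_dvd_pow_iff two_ne_zero).1 ⟨s * t, by rw [← h]; ring⟩
  have hst : s * t = w ^ 2 :=
    mul_left_cancel₀ (pow_ne_zero 2 hd) (by linear_combination h)
  obtain ⟨x, rfl⟩ := square_of_coprime hu hst
  obtain ⟨y, rfl⟩ := square_of_coprime ((gcd_comm' _ _).isUnit hu) ((mul_comm _ _).trans hst)
  obtain hw | hw := sq_eq_sq_iff_eq_or_eq_neg.1 (show w ^ 2 = (x * y) ^ 2 by rw [← hst]; ring)
  · exact ⟨d, x, y, rfl, rfl, by rw [hw]⟩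
  · exact ⟨d, x, -y, rfl, by ring, by rw [hw]; ring⟩

/-- Over an algebraically closed field, every unit of a polynomial ring is a square. -/
theorem MvPolynomial.isSquare_of_isUnit {σ K : Type*} [Field K] [IsAlgClosed K]
    {u : MvPolynomial σ K} (hu : IsUnit u) : IsSquare u := by
  obtain ⟨c, -, rfl⟩ := isUnit_iff_eq_C_of_isReduced.1 hu
  obtain ⟨z, rfl⟩ := IsAlgClosed.exists_eq_mul_self c
  exact ⟨C z, C_mul⟩

/-- If `p, q, r ∈ ℂ[x_1, …, x_n]` satisfy `p² + q² = r²`, then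
there exist `f, g, h ∈ ℂ[x_1, …, x_n]` with `p = f(g² − h²)`, `q = f(2gh)`,
and `r = f(g² + h²)`. -/
theorem pythagorean_polynomial_parametrization (n : ℕ) (hn : 1 ≤ n)
    (p q r : MvPolynomial (Fin n) ℂ) (h : p ^ 2 + q ^ 2 = r ^ 2) :
    ∃ f g h' : MvPolynomial (Fin n) ℂ,
      p = f * (g ^ 2 - h' ^ 2) ∧ q = f * (2 * g * h') ∧ r = f * (g ^ 2 + h' ^ 2) := by
  have : Nonempty (GCDMonoid (MvPolynomial (Fin n) ℂ)) :=
    ⟨UniqueFactorizationMonoid.toGCDMonoid _⟩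
  obtain ⟨_⟩ := this
  obtain ⟨d, x, y, hx, hy, hq⟩ := exists_eq_mul_sq_of_mul_eq_sq
    (fun _ => MvPolynomial.isSquare_of_isUnit) (show (r + p) * (r - p) = q ^ 2 by
      linear_combination -h)
  have half : (2 : MvPolynomial (Fin n) ℂ) * C (1 / 2) = 1 := by
    rw [show (2 : MvPolynomial (Fin n) ℂ) = C 2 from (map_ofNat C 2).symm, ← C_mul]
    norm_num
  refine ⟨C (1 / 2) * d, x, y, ?_, ?_, ?_⟩
  · linear_combination C (1 / 2) * (hx - hy) - p * half
  · linear_combination hq - d * x * y * half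
  · linear_combination C (1 / 2) * (hx + hy) - r * half
end
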